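/- Steady-state optimality (Corollary 8, with the homogeneity hypothesis that makes it precise): Let n ≥ 1, let B : Fin n → Fin n → ℝ be symmetric, V : Fin n → ℝ, D_i > 0, K_i > 0, P* ∈ ℝⁿ, and let (θ*, p*, ω_sync) be a leaky-integral equilibrium. Assume additionally that D_i K_i = D_j K_j for all i, j. Then the steady-state injections u* = −p* satisfy the modified power balance Σ_{i=1}^n P*_i + Σ_{i=1}^n (1 + D_i K_i) u*_i = 0, and u* minimizes Σ_{i=1}^n K_i u_i² over all u ∈ ℝⁿ satisfying Σ_{i=1}^n P*_i + Σ_{i=1}^n (1 + D_i K_i) u_i = 0; that is, every such feasible u satisfies Σ_i K_i u_i² ≥ Σ_i K_i (u*_i)². -/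

import Mathlib

/-- The net flow of an antisymmetric pairwise exchange vanishes. -/
theorem sum_sum_eq_zero_of_antisymm {ι : Type*} [Fintype ι] (f : ι → ι → ℝ)
    (hf : ∀ i j, f i j = -f j i) : ∑ i, ∑ j, f i j = 0 := by
  have h : ∑ i, ∑ j, f i j = -∑ i, ∑ j, f i j := by
    conv_lhs => rw [Finset.sum_comm]
    simp only [← Finset.sum_neg_distrib]
    exact Finset.sum_congr rfl fun i _ => Finset.sum_congr rfl fun j _ => hf j i
  linarith

/-- If the marginal costs `K i * v i` coincide, then `v` has least weighted quadratic cost among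
all vectors with the same sum. -/
theorem sum_mul_sq_le_of_marginal_eq {ι : Type*} [Fintype ι] {K v u : ι → ℝ} {c : ℝ}
    (hK : ∀ i, 0 ≤ K i) (hv : ∀ i, K i * v i = c) (hsum : ∑ i, u i = ∑ i, v i) :
    ∑ i, K i * v i ^ 2 ≤ ∑ i, K i * u i ^ 2 := by
  have h : ∑ i, (K i * v i ^ 2 + 2 * c * (u i - v i)) ≤ ∑ i, K i * u i ^ 2 := by
    refine Finset.sum_le_sum fun i _ => ?_
    rw [← hv i]
    linarith [mul_nonneg (hK i) (sq_nonneg (u i - v i))]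
  rwa [Finset.sum_add_distrib, ← Finset.mul_sum, Finset.sum_sub_distrib, hsum, sub_self,
    mul_zero, add_zero] at h


/-- Steady-state optimality (Corollary 8, with the homogeneity hypothesis
`D_i K_i = D_j K_j`): the steady-state injections `u* = −p*` of the leaky
integral controller satisfy the modified power balance
`Σ_i P*_i + Σ_i (1 + D_i K_i) u*_i = 0` and minimize `Σ_i K_i u_i²` over all
`u` satisfying this balance. -/
theorem leaky_integral_steady_state_optimality
    (n : ℕ) (hn : 1 ≤ n)
    (B : Fin n → Fin n → ℝ) (hB : ∀ i j, B i j = B j i)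
    (V D K Pstar θstar pstar : Fin n → ℝ)
    (hD : ∀ i, 0 < D i) (hK : ∀ i, 0 < K i)
    (ωsync : ℝ)
    (heq1 : ∀ i, (0 : ℝ) = - D i * ωsync + Pstar i
      - (∑ j, B i j * V i * V j * Real.sin (θstar i - θstar j)) - pstar i)
    (heq2 : ∀ i, (0 : ℝ) = ωsync - K i * pstar i)
    (hhom : ∀ i j, D i * K i = D j * K j)
    (ustar : Fin n → ℝ) (hustar : ∀ i, ustar i = - pstar i) :
    (∑ i, Pstar i + ∑ i, (1 + D i * K i) * ustar i = 0) ∧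
    (∀ u : Fin n → ℝ, ∑ i, Pstar i + ∑ i, (1 + D i * K i) * u i = 0 →
      ∑ i, K i * (u i)^2 ≥ ∑ i, K i * (ustar i)^2) := by
  have hflow : ∑ i, ∑ j, B i j * V i * V j * Real.sin (θstar i - θstar j) = 0 := by
    refine sum_sum_eq_zero_of_antisymm _ fun i j => ?_
    rw [hB i j, ← neg_sub (θstar j), Real.sin_neg]
    ring
  have hbal : ∑ i, Pstar i + ∑ i, (1 + D i * K i) * ustar i = 0 := by
    rw [← Finset.sum_add_distrib, ← hflow]
    refine Finset.sum_congr rfl fun i _ => ?_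
    rw [hustar i]
    linear_combination -heq1 i - D i * heq2 i
  refine ⟨hbal, fun u hu => ?_⟩
  let k : Fin n := ⟨0, hn⟩
  have hscale (w : Fin n → ℝ) :
      ∑ i, (1 + D i * K i) * w i = (1 + D k * K k) * ∑ i, w i := by
    simp only [hhom _ k, Finset.mul_sum]
  rw [hscale] at hu hbal
  have hpos : 0 < 1 + D k * K k := by
    have := mul_pos (hD k) (hK k)
    linarith
  refine sum_mul_sq_le_of_marginal_eq (c := -ωsync) (fun i => (hK i).le) (fun i => ?_)
    (mul_left_cancel₀ hpos.ne' (by linarith))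
  rw [hustar i]
  linear_combination -heq2 i
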